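/- (Correctness of the dynamic-programming recurrence for merging two strings.) Let s1 and s2 be strings (lists) over α of lengths n1 and n2, and for 0 ≤ i ≤ n1, 0 ≤ j ≤ n2 let M(i, j) denote the merging size msize of the two single-string paradigms determined by the length-i prefix of s1 and the length-j prefix of s2. Then M(0, 0) = 0; M(i, 0) = ∑_{k < i} d(s1[k], null); M(0, j) = ∑_{k < j} d(s2[k], null); and for i, j ≥ 1, M(i, j) = min( M(i−1, j) + d(s1[i−1], null), M(i, j−1) + d(s2[j−1], null), M(i−1, j−1) + d(s1[i−1], s2[j−1]) ). -/

import Mathlib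

/-- The size of a paradigm `P : I → Fin n → α`: the sum over columns of the metric
diameter of the column set `P[i] = {P s i : s ∈ I}`. -/
noncomputable def psize {α : Type*} [PseudoMetricSpace α] {I : Type*} {n : ℕ}
    (P : I → Fin n → α) : ℝ :=
  ∑ i : Fin n, Metric.diam (Set.range fun s => P s i)

/-- `Q` is a column-insertion of `P`: there is a strictly monotone map `f` of the columns
of `P` into the columns of `Q` such that `Q` agrees with `P` along `f` and is `null`
on all other columns. -/
def IsColInsertion {α : Type*} (null : α) {I : Type*} {n m : ℕ}
    (Q : I → Fin m → α) (P : I → Fin n → α) : Prop :=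
  ∃ f : Fin n → Fin m, StrictMono f ∧
    (∀ s i, Q s (f i) = P s i) ∧
    ∀ s j, j ∉ Set.range f → Q s j = null

/-- `Q` is a merged paradigm of `P1` and `P2`: its restriction to `I1` is a
column-insertion of `P1` and its restriction to `I2` is a column-insertion of `P2`. -/
def IsMergedParadigm {α : Type*} (null : α) {I1 I2 : Type*} {n1 n2 m : ℕ}
    (P1 : I1 → Fin n1 → α) (P2 : I2 → Fin n2 → α) (Q : I1 ⊕ I2 → Fin m → α) : Prop :=
  IsColInsertion null (fun s => Q (Sum.inl s)) P1 ∧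
  IsColInsertion null (fun s => Q (Sum.inr s)) P2

/-- The merging size `msize(P1, P2)`: the infimum of `size(Q)` over all merged
paradigms `Q` of `P1` and `P2`. -/
noncomputable def msize {α : Type*} [PseudoMetricSpace α] (null : α) {I1 I2 : Type*}
    {n1 n2 : ℕ} (P1 : I1 → Fin n1 → α) (P2 : I2 → Fin n2 → α) : ℝ :=
  sInf {r : ℝ | ∃ (m : ℕ) (Q : I1 ⊕ I2 → Fin m → α),
    IsMergedParadigm null P1 P2 Q ∧ psize Q = r}

/-- The single-string paradigm (over a one-element index set) determined by a list. -/
def listParadigm {α : Type*} (s : List α) : Unit → Fin s.length → α :=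
  fun _ i => s.get i

/-- Dropping the last column of a paradigm. -/
def initCols {α I : Type*} {n : ℕ} (P : I → Fin (n + 1) → α) : I → Fin n → α :=
  fun s i => P s i.castSucc

/-- Appending a column to a paradigm. -/
def snocCol {α I : Type*} {n : ℕ} (P : I → Fin n → α) (x : I → α) : I → Fin (n + 1) → α :=
  fun s => Fin.snoc (P s) (x s)

lemma IsColInsertion.snocCol_null {α I : Type*} {null : α} {n m : ℕ}
    {Q : I → Fin m → α} {P : I → Fin n → α} (h : IsColInsertion null Q P) :
    IsColInsertion null (snocCol Q fun _ => null) P := by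
  obtain ⟨f, hf, hQ, hnull⟩ := h
  refine ⟨fun i => (f i).castSucc, fun i j hij => hf hij, fun s i => ?_, fun s j hj => ?_⟩
  · simp [snocCol, hQ]
  · induction j using Fin.lastCases with
    | last => simp [snocCol]
    | cast j =>
      have : j ∉ Set.range f := by
        rintro ⟨i, rfl⟩
        exact hj ⟨i, rfl⟩
      simp [snocCol, hnull s j this]

lemma IsColInsertion.snocCol_last {α I : Type*} {null : α} {n m : ℕ}
    {Q : I → Fin m → α} {P : I → Fin (n + 1) → α} (h : IsColInsertion null Q (initCols P)) :
    IsColInsertion null (snocCol Q fun s => P s (Fin.last n)) P := by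
  obtain ⟨f, hf, hQ, hnull⟩ := h
  refine ⟨Fin.snoc (fun i => (f i).castSucc) (Fin.last m), ?_, fun s i => ?_, fun s j hj => ?_⟩
  · intro i j hij
    induction j using Fin.lastCases with
    | last =>
      induction i using Fin.lastCases with
      | last => exact absurd hij (lt_irrefl _)
      | cast i => simp
    | cast j =>
      induction i using Fin.lastCases with
      | last => exact absurd hij (Fin.castSucc_lt_last j).asymm
      | cast i => simpa using hf (Fin.castSucc_lt_castSucc_iff.1 hij)
  · induction i using Fin.lastCases with
    | last => simp [snocCol]
    | cast i => simp [snocCol, hQ, initCols]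
  · induction j using Fin.lastCases with
    | last => exact absurd ⟨Fin.last n, by simp⟩ hj
    | cast j =>
      have : j ∉ Set.range f := by
        rintro ⟨i, rfl⟩
        exact hj ⟨i.castSucc, by simp⟩
      simp [snocCol, hnull s j this]

lemma IsColInsertion.initCols_of_forall_ne {α I : Type*} {null : α} {n m : ℕ}
    {Q : I → Fin (m + 1) → α} {P : I → Fin n → α} {f : Fin n → Fin (m + 1)}
    (hf : StrictMono f) (hQ : ∀ s i, Q s (f i) = P s i)
    (hnull : ∀ s j, j ∉ Set.range f → Q s j = null) (hlast : ∀ i, f i ≠ Fin.last m) :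
    (∀ s, Q s (Fin.last m) = null) ∧ IsColInsertion null (initCols Q) P := by
  refine ⟨fun s => hnull s _ fun ⟨i, hi⟩ => hlast i hi,
    fun i => (f i).castPred (hlast i), fun i j hij => ?_, fun s i => ?_, fun s j hj => ?_⟩
  · simpa using hf hij
  · simp [initCols, hQ]
  · refine hnull s _ fun ⟨i, hi⟩ => hj ⟨i, ?_⟩
    simp [hi]

/-- The last column of a column-insertion is either inserted, or the last original column. -/
lemma IsColInsertion.last_cases {α I : Type*} {null : α} {n m : ℕ}
    {Q : I → Fin (m + 1) → α} {P : I → Fin (n + 1) → α} (h : IsColInsertion null Q P) :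
    ((∀ s, Q s (Fin.last m) = null) ∧ IsColInsertion null (initCols Q) P) ∨
    ((∀ s, Q s (Fin.last m) = P s (Fin.last n)) ∧
      IsColInsertion null (initCols Q) (initCols P)) := by
  obtain ⟨f, hf, hQ, hnull⟩ := h
  by_cases hlast : f (Fin.last n) = Fin.last m
  · right
    have hne : ∀ i : Fin n, f i.castSucc ≠ Fin.last m := fun i =>
      hlast ▸ (hf (Fin.castSucc_lt_last i)).ne
    refine ⟨fun s => by rw [← hQ, hlast],
      fun i => (f i.castSucc).castPred (hne i), fun i j hij => ?_, fun s i => ?_, fun s j hj => ?_⟩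
    · simpa using hf (Fin.castSucc_lt_castSucc_iff.2 hij)
    · simp [initCols, hQ]
    · refine hnull s _ fun ⟨i, hi⟩ => ?_
      induction i using Fin.lastCases with
      | last => exact (Fin.castSucc_lt_last j).ne (hi.symm.trans hlast)
      | cast i => exact hj ⟨i, by simp [hi]⟩
  · left
    refine IsColInsertion.initCols_of_forall_ne hf hQ hnull fun i hi => hlast ?_
    exact Fin.last_le_iff.1 (hi ▸ hf.monotone (Fin.le_last i))

lemma IsColInsertion.initCols_of_empty {α I : Type*} {null : α} {m : ℕ}
    {Q : I → Fin (m + 1) → α} {P : I → Fin 0 → α} (h : IsColInsertion null Q P) :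
    (∀ s, Q s (Fin.last m) = null) ∧ IsColInsertion null (initCols Q) P := by
  obtain ⟨f, hf, hQ, hnull⟩ := h
  exact IsColInsertion.initCols_of_forall_ne hf hQ hnull fun i => i.elim0

lemma psize_nonneg {α : Type*} [PseudoMetricSpace α] {I : Type*} {n : ℕ}
    (P : I → Fin n → α) : 0 ≤ psize P :=
  Finset.sum_nonneg fun _ _ => Metric.diam_nonneg

lemma diam_range_sum_unit {α : Type*} [PseudoMetricSpace α] (x : Unit ⊕ Unit → α) :
    Metric.diam (Set.range x) = dist (x (Sum.inl ())) (x (Sum.inr ())) := by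
  have : Set.range x = {x (Sum.inl ()), x (Sum.inr ())} := by
    ext y
    simp only [Set.mem_range, Sum.exists, Set.mem_insert_iff, Set.mem_singleton_iff,
      eq_comm (a := y)]
    exact or_congr ⟨fun ⟨_, h⟩ => h, fun h => ⟨(), h⟩⟩ ⟨fun ⟨_, h⟩ => h, fun h => ⟨(), h⟩⟩
  rw [this, Metric.diam_pair]

lemma psize_eq_initCols_add {α : Type*} [PseudoMetricSpace α] {m : ℕ}
    (Q : Unit ⊕ Unit → Fin (m + 1) → α) :
    psize Q = psize (initCols Q) +
      dist (Q (Sum.inl ()) (Fin.last m)) (Q (Sum.inr ()) (Fin.last m)) := by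
  rw [psize, Fin.sum_univ_castSucc, diam_range_sum_unit]
  rfl

lemma psize_snocCol {α : Type*} [PseudoMetricSpace α] {m : ℕ}
    (Q : Unit ⊕ Unit → Fin m → α) (x : Unit ⊕ Unit → α) :
    psize (snocCol Q x) = psize Q + dist (x (Sum.inl ())) (x (Sum.inr ())) := by
  have : initCols (snocCol Q x) = Q := by
    ext s i
    simp [snocCol, initCols]
  rw [psize_eq_initCols_add, this]
  simp [snocCol]

lemma IsMergedParadigm.swap {α : Type*} {null : α} {I1 I2 : Type*} {n1 n2 m : ℕ}
    {P1 : I1 → Fin n1 → α} {P2 : I2 → Fin n2 → α} {Q : I1 ⊕ I2 → Fin m → α}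
    (h : IsMergedParadigm null P1 P2 Q) :
    IsMergedParadigm null P2 P1 (Q ∘ Sum.swap) :=
  ⟨h.2, h.1⟩

lemma IsMergedParadigm.snocCol_left {α : Type*} {null : α} {n1 n2 m : ℕ}
    {P1 : Unit → Fin (n1 + 1) → α} {P2 : Unit → Fin n2 → α} {Q : Unit ⊕ Unit → Fin m → α}
    (h : IsMergedParadigm null (initCols P1) P2 Q) :
    IsMergedParadigm null P1 P2
      (snocCol Q (Sum.elim (fun s => P1 s (Fin.last n1)) fun _ => null)) :=
  ⟨h.1.snocCol_last, h.2.snocCol_null⟩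

lemma IsMergedParadigm.snocCol_both {α : Type*} {null : α} {n1 n2 m : ℕ}
    {P1 : Unit → Fin (n1 + 1) → α} {P2 : Unit → Fin (n2 + 1) → α} {Q : Unit ⊕ Unit → Fin m → α}
    (h : IsMergedParadigm null (initCols P1) (initCols P2) Q) :
    IsMergedParadigm null P1 P2
      (snocCol Q (Sum.elim (fun s => P1 s (Fin.last n1)) fun s => P2 s (Fin.last n2))) :=
  ⟨h.1.snocCol_last, h.2.snocCol_last⟩

lemma exists_isMergedParadigm {α : Type*} {null : α} {n1 n2 : ℕ}
    (P1 : Unit → Fin n1 → α) (P2 : Unit → Fin n2 → α) :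
    ∃ (m : ℕ) (Q : Unit ⊕ Unit → Fin m → α), IsMergedParadigm null P1 P2 Q := by
  induction n1 with
  | zero =>
    refine ⟨n2, Sum.elim (fun _ _ => null) P2, ⟨Fin.elim0, fun i => i.elim0, fun _ i => i.elim0,
      fun _ _ _ => rfl⟩, id, strictMono_id, fun _ _ => rfl, fun _ j hj => absurd ⟨j, rfl⟩ hj⟩
  | succ n1 ih =>
    obtain ⟨m, Q, hQ⟩ := ih (initCols P1)
    exact ⟨_, _, hQ.snocCol_left⟩

section Msize

variable {α : Type*} [PseudoMetricSpace α] {null : α}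

lemma msize_le_psize {I1 I2 : Type*} {n1 n2 m : ℕ} {P1 : I1 → Fin n1 → α}
    {P2 : I2 → Fin n2 → α} {Q : I1 ⊕ I2 → Fin m → α} (h : IsMergedParadigm null P1 P2 Q) :
    msize null P1 P2 ≤ psize Q :=
  csInf_le ⟨0, by rintro _ ⟨m, Q, -, rfl⟩; exact psize_nonneg Q⟩ ⟨m, Q, h, rfl⟩

lemma psize_comp_swap {I1 I2 : Type*} {m : ℕ} (Q : I1 ⊕ I2 → Fin m → α) :
    psize (Q ∘ Sum.swap) = psize Q := by
  refine Finset.sum_congr rfl fun i _ => congrArg Metric.diam ?_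
  exact (Equiv.sumComm I2 I1).surjective.range_comp fun s => Q s i

lemma msize_comm {I1 I2 : Type*} {n1 n2 : ℕ} (P1 : I1 → Fin n1 → α) (P2 : I2 → Fin n2 → α) :
    msize null P1 P2 = msize null P2 P1 := by
  refine congrArg sInf (Set.ext fun r => ⟨?_, ?_⟩) <;>
  · rintro ⟨m, Q, hQ, rfl⟩
    exact ⟨m, _, hQ.swap, psize_comp_swap Q⟩

lemma le_msize {n1 n2 : ℕ} {P1 : Unit → Fin n1 → α} {P2 : Unit → Fin n2 → α} {c : ℝ}
    (h : ∀ (m : ℕ) (Q : Unit ⊕ Unit → Fin m → α), IsMergedParadigm null P1 P2 Q → c ≤ psize Q) :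
    c ≤ msize null P1 P2 := by
  obtain ⟨m, Q, hQ⟩ := exists_isMergedParadigm (null := null) P1 P2
  refine le_csInf ⟨_, m, Q, hQ, rfl⟩ ?_
  rintro _ ⟨m, Q, hQ, rfl⟩
  exact h m Q hQ

lemma msize_le_initCols_left {n1 n2 : ℕ} (P1 : Unit → Fin (n1 + 1) → α)
    (P2 : Unit → Fin n2 → α) :
    msize null P1 P2 ≤ msize null (initCols P1) P2 + dist (P1 () (Fin.last n1)) null := by
  rw [← sub_le_iff_le_add]
  refine le_msize fun m Q hQ => ?_
  rw [sub_le_iff_le_add]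
  exact (msize_le_psize hQ.snocCol_left).trans_eq (psize_snocCol _ _)

lemma msize_le_initCols_both {n1 n2 : ℕ} (P1 : Unit → Fin (n1 + 1) → α)
    (P2 : Unit → Fin (n2 + 1) → α) :
    msize null P1 P2 ≤ msize null (initCols P1) (initCols P2) +
      dist (P1 () (Fin.last n1)) (P2 () (Fin.last n2)) := by
  rw [← sub_le_iff_le_add]
  refine le_msize fun m Q hQ => ?_
  rw [sub_le_iff_le_add]
  exact (msize_le_psize hQ.snocCol_both).trans_eq (psize_snocCol _ _)

lemma msize_empty_empty (P1 P2 : Unit → Fin 0 → α) : msize null P1 P2 = 0 := by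
  refine le_antisymm ?_ (le_msize fun m Q _ => psize_nonneg Q)
  refine (msize_le_psize (Q := fun _ => Fin.elim0) ⟨?_, ?_⟩).trans_eq (by simp [psize]) <;>
  exact ⟨id, strictMono_id, fun _ i => i.elim0, fun _ i => i.elim0⟩

lemma msize_succ_empty {n : ℕ} (P1 : Unit → Fin (n + 1) → α) (P2 : Unit → Fin 0 → α) :
    msize null P1 P2 = msize null (initCols P1) P2 + dist (P1 () (Fin.last n)) null := by
  refine le_antisymm (msize_le_initCols_left P1 P2) (le_msize fun m Q hQ => ?_)
  induction m with
  | zero =>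
    obtain ⟨f, -⟩ := hQ.1
    exact (f 0).elim0
  | succ m ih =>
    obtain ⟨h2, hQ2⟩ := hQ.2.initCols_of_empty
    rw [psize_eq_initCols_add, h2 ()]
    obtain ⟨-, hQ1⟩ | ⟨h1, hQ1⟩ := hQ.1.last_cases
    · exact (ih (initCols Q) ⟨hQ1, hQ2⟩).trans (le_add_of_nonneg_right dist_nonneg)
    · rw [h1 ()]
      gcongr
      exact msize_le_psize ⟨hQ1, hQ2⟩

lemma msize_empty_right {n : ℕ} (P1 : Unit → Fin n → α) (P2 : Unit → Fin 0 → α) :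
    msize null P1 P2 = ∑ k, dist (P1 () k) null := by
  induction n with
  | zero => simp [msize_empty_empty]
  | succ n ih =>
    rw [msize_succ_empty, ih, Fin.sum_univ_castSucc]
    rfl

lemma msize_succ_succ {n1 n2 : ℕ} (P1 : Unit → Fin (n1 + 1) → α)
    (P2 : Unit → Fin (n2 + 1) → α) :
    msize null P1 P2 = min (msize null (initCols P1) P2 + dist (P1 () (Fin.last n1)) null)
      (min (msize null P1 (initCols P2) + dist (P2 () (Fin.last n2)) null)
        (msize null (initCols P1) (initCols P2) +
          dist (P1 () (Fin.last n1)) (P2 () (Fin.last n2)))) := by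
  refine le_antisymm (le_min (msize_le_initCols_left P1 P2) (le_min ?_
    (msize_le_initCols_both P1 P2))) (le_msize fun m Q hQ => ?_)
  · rw [msize_comm P1, msize_comm P1]
    exact msize_le_initCols_left P2 P1
  induction m with
  | zero =>
    obtain ⟨f, -⟩ := hQ.1
    exact (f 0).elim0
  | succ m ih =>
    rw [psize_eq_initCols_add]
    obtain ⟨h1, hQ1⟩ | ⟨h1, hQ1⟩ := hQ.1.last_cases <;>
      obtain ⟨h2, hQ2⟩ | ⟨h2, hQ2⟩ := hQ.2.last_cases
    · exact (ih (initCols Q) ⟨hQ1, hQ2⟩).trans (le_add_of_nonneg_right dist_nonneg)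
    all_goals
      rw [h1 (), h2 ()]
      have := msize_le_psize (Q := initCols Q) ⟨hQ1, hQ2⟩
    · rw [dist_comm null]
      exact (min_le_right _ _).trans ((min_le_left _ _).trans (by gcongr))
    · exact (min_le_left _ _).trans (by gcongr)
    · exact (min_le_right _ _).trans ((min_le_right _ _).trans (by gcongr))

lemma msize_congr {n1 n1' n2 n2' : ℕ} {P1 : Unit → Fin n1 → α} {P1' : Unit → Fin n1' → α}
    {P2 : Unit → Fin n2 → α} {P2' : Unit → Fin n2' → α} (h1 : n1 = n1') (h2 : n2 = n2')
    (hP1 : ∀ s i, P1 s i = P1' s (i.cast h1)) (hP2 : ∀ s i, P2 s i = P2' s (i.cast h2)) :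
    msize null P1 P2 = msize null P1' P2' := by
  subst h1 h2
  rw [show P1 = P1' from funext₂ hP1, show P2 = P2' from funext₂ hP2]

/-- The paradigm of the length-`i` prefix of `s`, with columns indexed by `Fin i`. -/
def prefixParadigm {α : Type*} (s : List α) (i : ℕ) (hi : i ≤ s.length) : Unit → Fin i → α :=
  fun _ k => s.get ⟨k, k.isLt.trans_le hi⟩

lemma msize_take_take (s1 s2 : List α) {i j : ℕ} (hi : i ≤ s1.length) (hj : j ≤ s2.length) :
    msize null (listParadigm (s1.take i)) (listParadigm (s2.take j)) =
      msize null (prefixParadigm s1 i hi) (prefixParadigm s2 j hj) :=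
  msize_congr (List.length_take_of_le hi) (List.length_take_of_le hj)
    (fun _ _ => by simp [listParadigm, prefixParadigm])
    (fun _ _ => by simp [listParadigm, prefixParadigm])

end Msize

/-- **Correctness of the DP recurrence for merging two strings.**
For `0 ≤ i ≤ n1`, `0 ≤ j ≤ n2` let `M i j` be the merging size of the single-string
paradigms of the length-`i` prefix of `s1` and the length-`j` prefix of `s2`.  Then
`M 0 0 = 0`, `M i 0 = ∑_{k<i} d(s1[k], null)`, `M 0 j = ∑_{k<j} d(s2[k], null)`, and for
`i, j ≥ 1`,
`M i j = min (M (i-1) j + d(s1[i-1], null)) (min (M i (j-1) + d(s2[j-1], null))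
  (M (i-1) (j-1) + d(s1[i-1], s2[j-1])))`. -/
theorem dp_recurrence_correct {α : Type*} [PseudoMetricSpace α] (null : α)
    (s1 s2 : List α) :
    letI M : ℕ → ℕ → ℝ := fun i j =>
      msize null (listParadigm (s1.take i)) (listParadigm (s2.take j))
    (M 0 0 = 0) ∧
    (∀ i, (hi : i ≤ s1.length) →
      M i 0 = ∑ k : Fin i, dist (s1.get ⟨k, k.isLt.trans_le hi⟩) null) ∧
    (∀ j, (hj : j ≤ s2.length) →
      M 0 j = ∑ k : Fin j, dist (s2.get ⟨k, k.isLt.trans_le hj⟩) null) ∧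
    (∀ i j, (hi1 : 1 ≤ i) → (hj1 : 1 ≤ j) →
      (hi : i ≤ s1.length) → (hj : j ≤ s2.length) →
      M i j = min (M (i - 1) j + dist (s1.get ⟨i - 1, by omega⟩) null)
        (min (M i (j - 1) + dist (s2.get ⟨j - 1, by omega⟩) null)
          (M (i - 1) (j - 1) +
            dist (s1.get ⟨i - 1, by omega⟩) (s2.get ⟨j - 1, by omega⟩)))) := by
  refine ⟨?_, fun i hi => ?_, fun j hj => ?_, fun i j hi1 hj1 hi hj => ?_⟩
  · exact (msize_take_take s1 s2 (Nat.zero_le _) (Nat.zero_le _)).trans (msize_empty_empty _ _)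
  · exact (msize_take_take s1 s2 hi (Nat.zero_le _)).trans (msize_empty_right _ _)
  · exact (msize_take_take s1 s2 (Nat.zero_le _) hj).trans
      ((msize_comm _ _).trans (msize_empty_right _ _))
  · obtain ⟨i, rfl⟩ := Nat.exists_eq_add_of_le' hi1
    obtain ⟨j, rfl⟩ := Nat.exists_eq_add_of_le' hj1
    beta_reduce
    rw [msize_take_take s1 s2 hi hj,
      msize_take_take s1 s2 (i := i + 1 - 1) (Nat.le_of_succ_le hi) hj,
      msize_take_take s1 s2 (j := j + 1 - 1) hi (Nat.le_of_succ_le hj),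
      msize_take_take s1 s2 (i := i + 1 - 1) (j := j + 1 - 1)
        (Nat.le_of_succ_le hi) (Nat.le_of_succ_le hj)]
    exact msize_succ_succ _ _
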